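/- arXiv:1410.7934 — 2 statements merged into one kernel-verified Lean document; each statement's English description precedes it below -/
import Mathlib

section
/- Let α > 1 and let f belong to the Müntz class M_α. Then the Mellin transform f*(s) = ∫₀^∞ f(x) x^{s−1} dx is analytic in the strip 0 < Re s < α, satisfies f*(s) = O(|s|^{−2}) and is absolutely integrable over every vertical line Re s = σ with 0 < σ < α; moreover, for every x > 0 and every σ with 0 < σ < 1, the Müntz operator has the representation (Pf)(x) = (1/(2πi)) ∫_{σ−i∞}^{σ+i∞} ζ(s) f*(s) x^{−s} ds. -/
open MeasureTheory Filter Asymptotics Set Complex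

noncomputable section

/-- The Mellin transform of `f`. -/
def mellinT (f : ℝ → ℂ) (s : ℂ) : ℂ := ∫ x in Ioi (0:ℝ), (x : ℂ) ^ (s - 1) * f x

/-- The Müntz class `M_α`. -/
def MuntzClass (α : ℝ) (f : ℝ → ℂ) : Prop :=
  ContDiffOn ℝ 2 f (Ici 0) ∧
  ∀ j : ℕ, j ≤ 2 →
    (iteratedDerivWithin j f (Ici 0)) =O[atTop] fun x : ℝ => x ^ (-(α + (j : ℝ)))

/-- The Möbius transformation `(Θf)(x) = ∑ f(nx)`. -/
def thetaOp (f : ℝ → ℂ) (x : ℝ) : ℂ := ∑' n : ℕ, f ((n + 1 : ℝ) * x)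

/-- The Müntz operator. -/
def muntzOp (f : ℝ → ℂ) (x : ℝ) : ℂ :=
  thetaOp f x - (x : ℂ)⁻¹ * ∫ y in Ioi (0:ℝ), f y

/-- `(1/(2πi)) ∫_{σ-i∞}^{σ+i∞} g(s) ds`. -/
def lineIntegral (g : ℂ → ℂ) (σ : ℝ) : ℂ :=
  (2 * Real.pi)⁻¹ • ∫ t : ℝ, g (σ + t * Complex.I)

/-- The Fourier cosine transform. -/
def fourierCos (f : ℝ → ℂ) (x : ℝ) : ℂ :=
  (Real.sqrt (2 / Real.pi) : ℂ) * ∫ t in Ioi (0:ℝ), f t * (Real.cos (x * t) : ℂ)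

/-- The reduced Möbius operator. -/
def thetaHat (f : ℝ → ℂ) (x : ℝ) : ℂ :=
  ∑' n : ℕ, ((|ArithmeticFunction.moebius (n + 1)| : ℤ) : ℂ) * f ((n + 1 : ℝ) * x)

/-- The Voronoi operator. -/
def voronoiOp (f : ℝ → ℂ) (x : ℝ) : ℂ :=
  (∑' n : ℕ, ((n + 1 : ℕ).divisors.card : ℂ) * f ((n + 1 : ℝ) * x)) -
    ∫ y in Ioi (0:ℝ), f (x * y) *
      ((Real.log y + 2 * Real.eulerMascheroniConstant : ℝ) : ℂ)

open scoped Topology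

/-- Euler summation on one cell. -/
lemma euler_cell (u v : ℝ → ℂ) (n : ℕ) (hu : ContinuousOn u (Ici (n:ℝ)))
    (hv : ContinuousOn v (Ici (n:ℝ))) (huv : ∀ x : ℝ, (n:ℝ) < x → HasDerivAt u (v x) x) :
    ∫ y in (n:ℝ)..((n+1:ℕ):ℝ), ((Int.fract y : ℝ) : ℂ) * v y
      = u (n+1) - ∫ y in (n:ℝ)..((n+1:ℕ):ℝ), u y := by
  have hle : (n:ℝ) ≤ ((n+1:ℕ):ℝ) := by push_cast; linarith
  have h1 : ∫ y in (n:ℝ)..((n+1:ℕ):ℝ), ((Int.fract y : ℝ) : ℂ) * v y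
      = ∫ y in (n:ℝ)..((n+1:ℕ):ℝ), ((y:ℂ) - n) * v y := by
    rw [intervalIntegral.integral_of_le hle, intervalIntegral.integral_of_le hle,
      integral_Ioc_eq_integral_Ioo, integral_Ioc_eq_integral_Ioo]
    refine setIntegral_congr_fun measurableSet_Ioo fun y hy => ?_
    have hfl : ⌊y⌋ = (n:ℤ) := by
      rw [Int.floor_eq_iff]
      have h2 := hy.2
      push_cast at h2
      exact ⟨by exact_mod_cast hy.1.le, by exact_mod_cast h2⟩
    simp only [Int.fract, hfl]
    push_cast
    ring
  have hsub : uIcc (n:ℝ) ((n+1:ℕ):ℝ) ⊆ Ici (n:ℝ) := by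
    rw [uIcc_of_le hle]; exact Icc_subset_Ici_self
  rw [h1, intervalIntegral.integral_mul_deriv_eq_deriv_mul_of_hasDerivAt
    (u := fun y : ℝ => (y:ℂ) - n) (u' := fun _ => 1) (v := u) (v' := v)
    (by fun_prop) (hu.mono hsub)
    (fun x _ => by simpa using (HasDerivAt.ofReal_comp (hasDerivAt_id x)).sub_const (n:ℂ))
    (fun x hx => huv x (by rw [min_eq_left hle] at hx; exact hx.1))
    (by simp) ((hv.mono hsub).intervalIntegrable)]
  simp

lemma euler_partial (u v : ℝ → ℂ) (M : ℕ) (hu : ContinuousOn u (Ici (M:ℝ)))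
    (hv : ContinuousOn v (Ici (M:ℝ))) (huv : ∀ x : ℝ, (M:ℝ) < x → HasDerivAt u (v x) x)
    (hvi : IntegrableOn (fun y : ℝ => ((Int.fract y : ℝ) : ℂ) * v y) (Ioi (M:ℝ))) (k : ℕ) :
    ∫ y in (M:ℝ)..((M+k:ℕ):ℝ), ((Int.fract y : ℝ) : ℂ) * v y
      = ∑ n ∈ Finset.range k, u ((M + n : ℕ) + 1) - ∫ y in (M:ℝ)..((M+k:ℕ):ℝ), u y := by
  have hsub : ∀ j : ℕ, Ici ((M+j:ℕ):ℝ) ⊆ Ici (M:ℝ) := fun j =>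
    Ici_subset_Ici.2 (by push_cast; linarith [(Nat.cast_nonneg j : (0:ℝ) ≤ j)])
  induction k with
  | zero => simp
  | succ k ih =>
    have hle1 : (M:ℝ) ≤ ((M+k:ℕ):ℝ) := by push_cast; linarith [(Nat.cast_nonneg k : (0:ℝ) ≤ k)]
    have hle2 : ((M+k:ℕ):ℝ) ≤ ((M+(k+1):ℕ):ℝ) := by push_cast; linarith
    have hi : ∀ g : ℝ → ℂ, ContinuousOn g (Ici (M:ℝ)) → ∀ a b : ℝ, (M:ℝ) ≤ a → a ≤ b →
        IntervalIntegrable g volume a b := fun g hg a b ha hab =>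
      (hg.mono (by rw [uIcc_of_le hab]; exact fun x hx => ha.trans hx.1)).intervalIntegrable
    have hi' : ∀ a b : ℝ, (M:ℝ) ≤ a → a ≤ b →
        IntervalIntegrable (fun y : ℝ => ((Int.fract y : ℝ) : ℂ) * v y) volume a b := fun a b ha hab => by
      rw [intervalIntegrable_iff_integrableOn_Ioc_of_le hab]
      exact hvi.mono_set fun x hx => lt_of_le_of_lt ha hx.1
    rw [← intervalIntegral.integral_add_adjacent_intervals (hi' _ _ le_rfl hle1)
      (hi' _ _ hle1 hle2), ← intervalIntegral.integral_add_adjacent_intervals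
      (hi u hu _ _ le_rfl hle1) (hi u hu _ _ hle1 hle2), ih, Finset.sum_range_succ]
    have := euler_cell u v (M+k) (hu.mono (hsub k)) (hv.mono (hsub k))
      (fun x hx => huv x (lt_of_le_of_lt hle1 hx))
    rw [← add_assoc, this]
    ring

lemma integrableOn_fract_mul {v : ℝ → ℂ} {S : Set ℝ} (hv : IntegrableOn v S) :
    IntegrableOn (fun y : ℝ => ((Int.fract y : ℝ) : ℂ) * v y) S := by
  refine Integrable.mono hv ?_ ?_
  · exact (by fun_prop : Measurable fun y : ℝ => ((Int.fract y : ℝ) : ℂ)).aestronglyMeasurable.mul hv.1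
  · refine Eventually.of_forall fun y => ?_
    rw [norm_mul, Complex.norm_real, Real.norm_eq_abs, abs_of_nonneg (Int.fract_nonneg y)]
    exact mul_le_of_le_one_left (norm_nonneg _) (Int.fract_lt_one y).le

lemma euler_tendsto (u v : ℝ → ℂ) (M : ℕ) (hu : ContinuousOn u (Ici (M:ℝ)))
    (hv : ContinuousOn v (Ici (M:ℝ))) (huv : ∀ x : ℝ, (M:ℝ) < x → HasDerivAt u (v x) x)
    (hui : IntegrableOn u (Ioi (M:ℝ))) (hvi : IntegrableOn v (Ioi (M:ℝ))) :
    Tendsto (fun k : ℕ => ∑ n ∈ Finset.range k, u ((M + n : ℕ) + 1)) atTop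
      (𝓝 ((∫ y in Ioi (M:ℝ), ((Int.fract y : ℝ) : ℂ) * v y) + ∫ y in Ioi (M:ℝ), u y)) := by
  have ht : Tendsto (fun k : ℕ => ((M+k:ℕ):ℝ)) atTop atTop :=
    tendsto_natCast_atTop_atTop.comp (tendsto_atTop_mono (fun k => Nat.le_add_left k M) tendsto_id)
  have h1 := intervalIntegral_tendsto_integral_Ioi (M:ℝ) (integrableOn_fract_mul hvi) ht
  have h2 := intervalIntegral_tendsto_integral_Ioi (M:ℝ) hui ht
  refine (h1.add h2).congr fun k => ?_
  rw [euler_partial u v M hu hv huv (integrableOn_fract_mul hvi) k]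
  ring

/-- The tail function whose Mellin transform gives the zeta remainder. -/
def fractTail (M : ℕ) (x : ℝ) : ℂ := (Ioi (M:ℝ)).indicator (fun y : ℝ => ((Int.fract y : ℝ) : ℂ)) x

lemma fractTail_locInt (M : ℕ) : LocallyIntegrableOn (fractTail M) (Ioi 0) := by
  have : LocallyIntegrable (fractTail M) := by
    refine (locallyIntegrable_const (1:ℝ)).mono ?_ ?_
    · exact ((by fun_prop : Measurable fun y : ℝ => ((Int.fract y : ℝ) : ℂ)).indicator
        measurableSet_Ioi).aestronglyMeasurable
    · refine Eventually.of_forall fun y => ?_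
      unfold fractTail
      refine (norm_indicator_le_norm_self _ _).trans ?_
      rw [Complex.norm_real, Real.norm_eq_abs, abs_of_nonneg (Int.fract_nonneg y)]
      simpa using (Int.fract_lt_one y).le
  exact this.locallyIntegrableOn _

lemma fractTail_top (M : ℕ) : fractTail M =O[atTop] fun x : ℝ => x ^ (-(0:ℝ)) := by
  refine IsBigO.of_bound 1 (Eventually.of_forall fun y => ?_)
  unfold fractTail
  refine (norm_indicator_le_norm_self _ _).trans ?_
  rw [Complex.norm_real, Real.norm_eq_abs, abs_of_nonneg (Int.fract_nonneg y)]
  simpa using (Int.fract_lt_one y).le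

lemma fractTail_bot (M : ℕ) (hM : 1 ≤ M) (b : ℝ) :
    fractTail M =O[𝓝[>] 0] fun x : ℝ => x ^ (-b) := by
  have : fractTail M =ᶠ[𝓝[>] 0] fun _ => 0 := by
    have : Iio (1:ℝ) ∈ 𝓝[>] (0:ℝ) := mem_nhdsWithin_of_mem_nhds (Iio_mem_nhds one_pos)
    filter_upwards [this] with x hx
    refine indicator_of_notMem ?_ _
    have : (1:ℝ) ≤ M := by exact_mod_cast hM
    simp only [mem_Ioi, not_lt]
    exact (le_of_lt hx).trans this
  exact this.trans_isBigO (isBigO_zero _ _)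

lemma mellin_fractTail_diff (M : ℕ) (hM : 1 ≤ M) {s : ℂ} (hs : 0 < s.re) :
    DifferentiableAt ℂ (fun s => mellin (fractTail M) (-s)) s := by
  have h := mellin_differentiableAt_of_isBigO_rpow (s := -s) (fractTail_locInt M)
    (fractTail_top M) (by simpa using hs) (fractTail_bot M hM (-s.re - 1)) (by simp)
  exact h.comp s differentiable_neg.differentiableAt

lemma mellin_fractTail_eq (M : ℕ) (s : ℂ) :
    mellin (fractTail M) (-s) = ∫ y in Ioi (M:ℝ), ((Int.fract y : ℝ) : ℂ) * (y:ℂ) ^ (-s-1) := by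
  have hsub : Ioi (M:ℝ) ⊆ Ioi 0 := Ioi_subset_Ioi (Nat.cast_nonneg M)
  have h : ∀ t : ℝ, (t:ℂ) ^ (-s-1) • fractTail M t
      = (Ioi (M:ℝ)).indicator (fun y : ℝ => ((Int.fract y : ℝ) : ℂ) * (y:ℂ) ^ (-s-1)) t := by
    intro t
    unfold fractTail
    by_cases ht : t ∈ Ioi (M:ℝ)
    · simp [indicator_of_mem ht, mul_comm]
    · simp [indicator_of_notMem ht]
  simp only [mellin, h]
  rw [setIntegral_indicator measurableSet_Ioi, inter_eq_right.2 hsub]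

/-- Right-hand side of the truncated zeta formula. -/
def zetaRHS (M : ℕ) (s : ℂ) : ℂ :=
  ∑ n ∈ Finset.range M, ((n:ℂ)+1) ^ (-s) + (M:ℂ) ^ (1-s) / (s-1) - s * mellin (fractTail M) (-s)

lemma zeta_eq_rhs_of_one_lt (M : ℕ) (hM : 1 ≤ M) {s : ℂ} (hs : 1 < s.re) :
    riemannZeta s = zetaRHS M s := by
  have hM0 : (0:ℝ) < M := by exact_mod_cast hM
  have hs0 : s ≠ 0 := fun h => by simp [h] at hs; linarith
  have hpos : ∀ x ∈ Ici (M:ℝ), 0 < x := fun x hx => hM0.trans_le hx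
  have hcont : ∀ r : ℂ, ContinuousOn (fun y : ℝ => (y:ℂ) ^ r) (Ici (M:ℝ)) := fun r x hx =>
    (Complex.continuousAt_ofReal_cpow_const _ _ (Or.inr (hpos x hx).ne')).continuousWithinAt
  have hder : ∀ x : ℝ, (M:ℝ) < x →
      HasDerivAt (fun y : ℝ => (y:ℂ) ^ (-s)) ((-s) * (x:ℂ) ^ (-s-1)) x := fun x hx =>
    hasDerivAt_ofReal_cpow_const (hpos x hx.le).ne' (neg_ne_zero.2 hs0)
  have h1 := euler_tendsto (fun y : ℝ => (y:ℂ) ^ (-s)) (fun y : ℝ => (-s) * (y:ℂ) ^ (-s-1)) M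
    (hcont _) ((hcont _).const_smul (-s)) hder
    (integrableOn_Ioi_cpow_of_lt (by simpa using hs) hM0)
    ((integrableOn_Ioi_cpow_of_lt (by simp; linarith) hM0).const_mul _)
  have hsum : HasSum (fun n : ℕ => ((n:ℂ)+1) ^ (-s)) (riemannZeta s) := by
    rw [zeta_eq_tsum_one_div_nat_add_one_cpow hs]
    have : Summable fun n : ℕ => 1 / ((n:ℂ)+1) ^ s := by
      have := (summable_nat_add_iff 1).2 (Complex.summable_one_div_nat_cpow.2 hs)
      simpa using this
    simpa [Complex.cpow_neg] using this.hasSum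
  have h2 := ((hasSum_nat_add_iff' M).2 hsum).tendsto_sum_nat
  have h3 := tendsto_nhds_unique h1 (h2.congr fun k => Finset.sum_congr rfl fun n _ => by
    push_cast; rw [add_comm (n:ℂ) M])
  rw [integral_Ioi_cpow_of_lt (by simpa using hs) hM0] at h3
  have h4 : ∫ y in Ioi (M:ℝ), ((Int.fract y : ℝ) : ℂ) * ((-s) * (y:ℂ) ^ (-s-1))
      = -s * mellin (fractTail M) (-s) := by
    rw [mellin_fractTail_eq, ← integral_const_mul]
    exact integral_congr_ae (Eventually.of_forall fun y => by ring)
  rw [h4] at h3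
  have hs1 : s - 1 ≠ 0 := fun h => by
    have : s = 1 := by linear_combination h
    simp [this] at hs
  have h5 : -((M:ℝ):ℂ) ^ (-s+1) / (-s+1) = (M:ℂ) ^ (1-s) / (s-1) := by
    rw [show -s+1 = 1 - s by ring, show (1:ℂ) - s = -(s-1) by ring, neg_div_neg_eq]
    simp
  rw [h5] at h3
  unfold zetaRHS
  linear_combination -h3

lemma zetaRHS_diff (M : ℕ) (hM : 1 ≤ M) {s : ℂ} (hs : 0 < s.re) (hs1 : s ≠ 1) :
    DifferentiableAt ℂ (zetaRHS M) s := by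
  unfold zetaRHS
  have hM0 : (M:ℂ) ≠ 0 := by exact_mod_cast (by omega : M ≠ 0)
  refine DifferentiableAt.sub (DifferentiableAt.add ?_ ?_) ?_
  · refine DifferentiableAt.fun_sum fun n _ => ?_
    exact DifferentiableAt.const_cpow (by fun_prop) (Or.inl (by exact_mod_cast n.succ_ne_zero))
  · exact (DifferentiableAt.const_cpow (by fun_prop) (Or.inl hM0)).div (by fun_prop)
      (sub_ne_zero.2 hs1)
  · exact differentiableAt_id.mul (mellin_fractTail_diff M hM hs)

lemma zeta_eq_rhs (M : ℕ) (hM : 1 ≤ M) {s : ℂ} (hs : 0 < s.re) (hi : s.im ≠ 0) :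
    riemannZeta s = zetaRHS M s := by
  -- work in the quarter plane of `s`
  let U : Set ℂ := {z | 0 < z.re ∧ 0 < s.im * z.im}
  have hUo : IsOpen U :=
    (isOpen_lt continuous_const Complex.continuous_re).inter
      (isOpen_lt continuous_const (continuous_const.mul Complex.continuous_im))
  have hUc : Convex ℝ U := by
    refine (convex_halfSpace_re_gt 0).inter ?_
    have : IsLinearMap ℝ fun z : ℂ => s.im * z.im :=
      ⟨fun x y => by simp [mul_add], fun c x => by simp; ring⟩
    exact convex_halfSpace_gt this 0
  have hne : ∀ z ∈ U, z ≠ 1 := fun z hz h => by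
    have := hz.2
    simp [h] at this
  have hz : AnalyticOnNhd ℂ riemannZeta U := DifferentiableOn.analyticOnNhd
    (fun z hz => (differentiableAt_riemannZeta (hne z hz)).differentiableWithinAt) hUo
  have hr : AnalyticOnNhd ℂ (zetaRHS M) U := DifferentiableOn.analyticOnNhd
    (fun z hz => (zetaRHS_diff M hM hz.1 (hne z hz)).differentiableWithinAt) hUo
  have h0 : (2 + s.im * I : ℂ) ∈ U := by
    constructor
    · simp
    · simpa using mul_self_pos.2 hi
  have hev : riemannZeta =ᶠ[𝓝 (2 + s.im * I : ℂ)] zetaRHS M := by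
    have : {z : ℂ | 1 < z.re} ∈ 𝓝 (2 + s.im * I : ℂ) :=
      (isOpen_lt continuous_const Complex.continuous_re).mem_nhds (by simp)
    filter_upwards [this] with z hz using zeta_eq_rhs_of_one_lt M hM hz
  exact hz.eqOn_of_preconnected_of_eventuallyEq hr hUc.isPreconnected h0 hev
    ⟨hs, mul_self_pos.2 hi⟩

lemma fract_ae_Ioc (s : ℂ) : (fun y : ℝ => ((Int.fract y : ℝ) : ℂ) * (y:ℂ) ^ (-s-1))
    =ᵐ[volume.restrict (Ioc 0 1)] fun y : ℝ => (y:ℂ) ^ (-s) := by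
  rw [← restrict_Ioo_eq_restrict_Ioc]
  filter_upwards [ae_restrict_mem measurableSet_Ioo] with y hy
  have hy0 : (y:ℂ) ≠ 0 := by exact_mod_cast hy.1.ne'
  rw [Int.fract_eq_self.2 ⟨hy.1.le, hy.2⟩, Complex.cpow_sub _ _ hy0, Complex.cpow_one]
  field_simp

lemma integrableOn_fract_cpow {s : ℂ} (hs : 0 < s.re) (hs1 : s.re < 1) :
    IntegrableOn (fun y : ℝ => ((Int.fract y : ℝ) : ℂ) * (y:ℂ) ^ (-s-1)) (Ioi 0) := by
  rw [← Ioc_union_Ioi_eq_Ioi (zero_le_one' ℝ)]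
  refine IntegrableOn.union ?_ (integrableOn_fract_mul
    (integrableOn_Ioi_cpow_of_lt (by simp; linarith) one_pos))
  refine Integrable.congr ?_ (fract_ae_Ioc s).symm
  have := intervalIntegral.intervalIntegrable_cpow' (r := -s) (a := 0) (b := 1)
    (by simp; linarith)
  rwa [intervalIntegrable_iff_integrableOn_Ioc_of_le zero_le_one] at this

lemma integral_fract_cpow {s : ℂ} (hs : 0 < s.re) (hs1 : s.re < 1) (hi : s.im ≠ 0) :
    -s * ∫ y in Ioi (0:ℝ), ((Int.fract y : ℝ) : ℂ) * (y:ℂ) ^ (-s-1) = riemannZeta s := by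
  have hI := integrableOn_fract_cpow hs hs1
  rw [← Ioc_union_Ioi_eq_Ioi (zero_le_one' ℝ)] at hI ⊢
  rw [setIntegral_union (Ioc_disjoint_Ioi le_rfl) measurableSet_Ioi hI.left_of_union
    hI.right_of_union, integral_congr_ae (fract_ae_Ioc s),
    ← intervalIntegral.integral_of_le zero_le_one,
    integral_cpow (Or.inl (by simp; linarith)), zeta_eq_rhs 1 le_rfl hs hi]
  unfold zetaRHS
  rw [mellin_fractTail_eq]
  have hne : s ≠ 1 := fun h => hi (by simp [h])
  have h1 : s - 1 ≠ 0 := sub_ne_zero.2 hne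
  have h2 : -s + 1 ≠ 0 := fun h => h1 (by linear_combination -h)
  simp only [Finset.range_one, Finset.sum_singleton, Nat.cast_zero, zero_add, Complex.one_cpow,
    Nat.cast_one, Complex.ofReal_one, Complex.ofReal_zero, Complex.zero_cpow h2]
  field_simp
  ring

lemma norm_fractTail_le (M : ℕ) (hM : 1 ≤ M) {s : ℂ} (hs : 0 < s.re) :
    ‖mellin (fractTail M) (-s)‖ ≤ (M:ℝ) ^ (-s.re) / s.re := by
  have hM0 : (0:ℝ) < M := by exact_mod_cast hM
  rw [mellin_fractTail_eq]
  have h := integral_Ioi_rpow_of_lt (a := -s.re - 1) (by linarith) hM0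
  have hi := integrableOn_Ioi_rpow_of_lt (a := -s.re - 1) (by linarith) hM0
  refine (norm_integral_le_of_norm_le hi ?_).trans (le_of_eq ?_)
  · filter_upwards [ae_restrict_mem measurableSet_Ioi] with y hy
    have hy0 : 0 < y := hM0.trans hy
    rw [norm_mul, Complex.norm_real, Real.norm_eq_abs, abs_of_nonneg (Int.fract_nonneg y),
      Complex.norm_cpow_eq_rpow_re_of_pos hy0]
    simp only [sub_re, neg_re, one_re]
    exact mul_le_of_le_one_left (by positivity) (Int.fract_lt_one y).le
  · rw [h]
    simp [neg_div_neg_eq]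

lemma zeta_bound {σ : ℝ} (h0 : 0 < σ) (h1 : σ < 1) {t : ℝ} (ht : 1 ≤ |t|) :
    ‖riemannZeta (σ + t * I)‖ ≤ (4 + 2 / σ) * |t| ^ (1 - σ / 2) := by
  have ht0 : 0 < |t| := by linarith
  set s : ℂ := σ + t * I with hs
  have hre : s.re = σ := by simp [hs]
  have him : s.im = t := by simp [hs]
  set M : ℕ := ⌈|t| ^ (1/2:ℝ)⌉₊ with hMdef
  have hr1 : 1 ≤ |t| ^ (1/2:ℝ) := Real.one_le_rpow ht (by norm_num)
  have hMge : |t| ^ (1/2:ℝ) ≤ M := Nat.le_ceil _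
  have hMle : (M:ℝ) ≤ 2 * |t| ^ (1/2:ℝ) := by
    have := Nat.ceil_lt_add_one (by positivity : 0 ≤ |t| ^ (1/2:ℝ))
    rw [← hMdef] at this
    linarith
  have hM1 : (1:ℝ) ≤ M := hr1.trans hMge
  have hM : 1 ≤ M := by exact_mod_cast hM1
  have hM0 : (0:ℝ) < M := by linarith
  have hhalf : |t| ^ (1/2:ℝ) ≤ |t| ^ (1 - σ/2) := Real.rpow_le_rpow_of_exponent_le ht (by linarith)
  rw [zeta_eq_rhs M hM (by rw [hre]; exact h0)
    (by rw [him]; exact fun h => by simp [h] at ht; linarith)]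
  unfold zetaRHS
  have hA : ‖∑ n ∈ Finset.range M, ((n:ℂ)+1) ^ (-s)‖ ≤ 2 * |t| ^ (1/2:ℝ) := by
    refine (norm_sum_le_of_le (n := fun _ => (1:ℝ)) _ fun n _ => ?_).trans ?_
    · have hp : (0:ℝ) < (n:ℝ)+1 := by positivity
      have := Complex.norm_cpow_eq_rpow_re_of_pos hp (-s)
      push_cast at this
      rw [this]
      exact Real.rpow_le_one_of_one_le_of_nonpos (by linarith [(Nat.cast_nonneg n : (0:ℝ) ≤ n)])
        (by simp [hre, h0.le])
    · simpa using hMle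
  have hB : ‖(M:ℂ) ^ (1-s) / (s-1)‖ ≤ 2 * |t| ^ (1/2:ℝ) := by
    rw [norm_div]
    have := Complex.norm_cpow_eq_rpow_re_of_pos hM0 (1-s)
    push_cast at this
    rw [this]
    have hden : 1 ≤ ‖s - 1‖ := by
      have := Complex.abs_im_le_norm (s-1)
      simp only [sub_im, him, one_im, sub_zero] at this
      linarith
    refine (div_le_self (by positivity) hden).trans ?_
    refine le_trans ?_ hMle
    calc (M:ℝ) ^ (1-s).re ≤ (M:ℝ) ^ (1:ℝ) :=
          Real.rpow_le_rpow_of_exponent_le hM1 (by simp [hre, h0.le])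
      _ = M := Real.rpow_one _
  have hC : ‖s * mellin (fractTail M) (-s)‖ ≤ 2 / σ * |t| ^ (1 - σ/2) := by
    rw [norm_mul]
    have hsn : ‖s‖ ≤ 2 * |t| := by
      have : ‖s‖ ≤ |s.re| + |s.im| := Complex.norm_le_abs_re_add_abs_im s
      rw [hre, him, abs_of_pos h0] at this
      linarith
    have hf := norm_fractTail_le M hM (s := s) (by rw [hre]; exact h0)
    rw [hre] at hf
    have hMs : (M:ℝ) ^ (-σ) ≤ |t| ^ (-(σ/2)) := by
      calc (M:ℝ) ^ (-σ) ≤ (|t| ^ (1/2:ℝ)) ^ (-σ) :=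
            Real.rpow_le_rpow_of_nonpos (by positivity) hMge (by linarith)
        _ = |t| ^ (-(σ/2)) := by rw [← Real.rpow_mul ht0.le]; ring_nf
    calc ‖s‖ * ‖mellin (fractTail M) (-s)‖ ≤ (2 * |t|) * (|t| ^ (-(σ/2)) / σ) := by
          gcongr
          exact hf.trans (by gcongr)
      _ = 2 / σ * |t| ^ (1 - σ/2) := by
          rw [sub_eq_add_neg, Real.rpow_add ht0, Real.rpow_one]
          ring
  calc _ ≤ ‖∑ n ∈ Finset.range M, ((n:ℂ)+1) ^ (-s)‖ + ‖(M:ℂ) ^ (1-s) / (s-1)‖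
        + ‖s * mellin (fractTail M) (-s)‖ := (norm_sub_le _ _).trans (by gcongr; exact norm_add_le _ _)
    _ ≤ (4 + 2 / σ) * |t| ^ (1 - σ / 2) := by linarith

lemma integrable_of_decay {g : ℝ → ℂ} (hg : Continuous g) {C r : ℝ} (hr : 1 < r)
    (hb : ∀ t : ℝ, 1 ≤ |t| → ‖g t‖ ≤ C * |t| ^ (-r)) : Integrable g := by
  obtain ⟨B, hB⟩ := (isCompact_Icc (a := (-1:ℝ)) (b := 1)).exists_bound_of_continuousOn
    hg.continuousOn
  have hC : 0 ≤ C := by simpa using (norm_nonneg _).trans (hb 1 (by simp))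
  have hB0 : 0 ≤ B := (norm_nonneg _).trans (hB 0 (by simp))
  have hint : Integrable (fun x : ℝ => (1 + ‖x‖) ^ (-r)) volume :=
    integrable_one_add_norm (by simpa using hr)
  refine Integrable.mono' (hint.const_mul ((B + C) * 2 ^ r)) hg.aestronglyMeasurable
    (Eventually.of_forall fun t => ?_)
  rw [Real.norm_eq_abs]
  have key : ∀ a : ℝ, 0 < a → 1 + |t| ≤ 2 * a → a ^ (-r) ≤ 2 ^ r * (1+|t|) ^ (-r) := by
    intro a ha h
    have h1 : (2 * a) ^ (-r) ≤ (1+|t|) ^ (-r) :=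
      Real.rpow_le_rpow_of_nonpos (by positivity) h (by linarith)
    rw [Real.mul_rpow (by norm_num) ha.le] at h1
    calc a ^ (-r) = 2 ^ r * (2 ^ (-r) * a ^ (-r)) := by
          rw [← mul_assoc, ← Real.rpow_add (by norm_num)]; simp
      _ ≤ _ := by gcongr
  have hP : 0 ≤ 2 ^ r * (1+|t|) ^ (-r) := by positivity
  rcases le_total 1 |t| with h | h
  · have := key |t| (by linarith) (by linarith)
    calc ‖g t‖ ≤ C * |t| ^ (-r) := hb t h
      _ ≤ C * (2 ^ r * (1+|t|) ^ (-r)) := by gcongr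
      _ ≤ (B + C) * 2 ^ r * (1+|t|) ^ (-r) := by nlinarith
  · have := key 1 one_pos (by linarith)
    rw [Real.one_rpow] at this
    have h2 := hB t (abs_le.1 h)
    calc ‖g t‖ ≤ B * 1 := by linarith
      _ ≤ B * (2 ^ r * (1+|t|) ^ (-r)) := by gcongr
      _ ≤ (B + C) * 2 ^ r * (1+|t|) ^ (-r) := by nlinarith

lemma bot_bigO {g : ℝ → ℂ} (hg : ContinuousOn g (Ici 0)) :
    g =O[𝓝[>] 0] fun x : ℝ => x ^ (-(0:ℝ)) := by
  have h : Tendsto g (𝓝[>] 0) (𝓝 (g 0)) :=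
    ((hg 0 self_mem_Ici).mono Ioi_subset_Ici_self).tendsto
  simpa using h.isBigO_one ℝ

lemma loc_int {g : ℝ → ℂ} (hg : ContinuousOn g (Ici 0)) : LocallyIntegrableOn g (Ioi 0) :=
  (hg.mono Ioi_subset_Ici_self).locallyIntegrableOn measurableSet_Ioi

lemma conv_of_class {g : ℝ → ℂ} {β : ℝ} (hg : ContinuousOn g (Ici 0))
    (ho : g =O[atTop] fun x : ℝ => x ^ (-β)) {s : ℂ} (h0 : 0 < s.re) (h1 : s.re < β) :
    MellinConvergent g s :=
  mellinConvergent_of_isBigO_rpow (loc_int hg) ho h1 (bot_bigO hg) h0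

lemma diff_of_class {g : ℝ → ℂ} {β : ℝ} (hg : ContinuousOn g (Ici 0))
    (ho : g =O[atTop] fun x : ℝ => x ^ (-β)) {s : ℂ} (h0 : 0 < s.re) (h1 : s.re < β) :
    DifferentiableAt ℂ (mellin g) s :=
  mellin_differentiableAt_of_isBigO_rpow (loc_int hg) ho h1 (bot_bigO hg) h0

/-- Integration by parts for Mellin transforms. -/
lemma mellin_ibp {u v : ℝ → ℂ} {β : ℝ} (hu : ContinuousOn u (Ici 0)) (hv : ContinuousOn v (Ici 0))
    (huv : ∀ x : ℝ, 0 < x → HasDerivAt u (v x) x)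
    (hou : u =O[atTop] fun x : ℝ => x ^ (-β)) (hov : v =O[atTop] fun x : ℝ => x ^ (-(β+1)))
    {s : ℂ} (h0 : 0 < s.re) (h1 : s.re < β) :
    mellin v (s+1) = -s * mellin u s := by
  have hs0 : s ≠ 0 := fun h => by simp [h] at h0
  have hcu : IntegrableOn (fun x : ℝ => (x:ℂ) ^ (s-1) • u x) (Ioi 0) := conv_of_class hu hou h0 h1
  have hcv : IntegrableOn (fun x : ℝ => (x:ℂ) ^ (s+1-1) • v x) (Ioi 0) :=
    conv_of_class hv hov (by simp; linarith) (by simpa using h1)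
  rw [add_sub_cancel_right] at hcv
  have hz : Tendsto ((fun x : ℝ => (x:ℂ) ^ s) * u) (𝓝[>] 0) (𝓝 0) := by
    have h2 : Tendsto u (𝓝[>] 0) (𝓝 (u 0)) :=
      ((hu 0 self_mem_Ici).mono Ioi_subset_Ici_self).tendsto
    have h3 : Tendsto (fun x : ℝ => (x:ℂ) ^ s) (𝓝[>] 0) (𝓝 0) := by
      have := (Complex.continuousAt_ofReal_cpow_const 0 s (Or.inl h0)).tendsto
      simp only [Complex.ofReal_zero, Complex.zero_cpow hs0] at this
      exact this.mono_left nhdsWithin_le_nhds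
    have h4 := h3.mul h2
    rw [zero_mul] at h4
    exact h4
  have hinf : Tendsto ((fun x : ℝ => (x:ℂ) ^ s) * u) atTop (𝓝 0) := by
    have h2 : ((fun x : ℝ => (x:ℂ) ^ s) * u) =O[atTop] fun x : ℝ => x ^ (-(β - s.re)) := by
      have h3 : (fun x : ℝ => (x:ℂ) ^ s) =O[atTop] fun x : ℝ => x ^ s.re := by
        refine IsBigO.of_bound 1 ?_
        filter_upwards [eventually_gt_atTop 0] with x hx
        rw [Complex.norm_cpow_eq_rpow_re_of_pos hx, one_mul]
        exact le_abs_self _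
      refine (h3.mul hou).congr' EventuallyEq.rfl ?_
      filter_upwards [eventually_gt_atTop 0] with x hx
      rw [← Real.rpow_add hx]
      ring_nf
    exact h2.trans_tendsto (tendsto_rpow_neg_atTop (by linarith))
  have h := integral_Ioi_mul_deriv_eq_deriv_mul (a := 0) (u := fun x : ℝ => (x:ℂ) ^ s)
    (u' := fun x : ℝ => s * (x:ℂ) ^ (s-1)) (v := u) (v' := v)
    (fun x hx => hasDerivAt_ofReal_cpow_const (ne_of_gt hx) hs0) (fun x hx => huv x hx)
    hcv (by
      refine (hcu.const_mul s).congr (Eventually.of_forall fun x => ?_)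
      simp [mul_assoc]) hz hinf
  simp only [mellin, add_sub_cancel_right, smul_eq_mul]
  rw [h, sub_zero, zero_sub, neg_mul, ← integral_const_mul]
  simp [mul_assoc]

lemma fubini_aux {φ H : ℝ → ℂ} (hφ : Measurable φ)
    (hφi : IntegrableOn (fun u : ℝ => φ u * (u:ℂ)⁻¹) (Ioi 0))
    (hH : ContinuousOn H (Ioi 0)) (hHi : IntegrableOn H (Ioi 0)) :
    Integrable (fun p : ℝ × ℝ => φ p.2 * H (p.2 * p.1))
      ((volume.restrict (Ioi (0:ℝ))).prod (volume.restrict (Ioi (0:ℝ)))) := by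
  have hm : AEStronglyMeasurable (fun p : ℝ × ℝ => φ p.2 * H (p.2 * p.1))
      ((volume.restrict (Ioi (0:ℝ))).prod (volume.restrict (Ioi (0:ℝ)))) := by
    refine AEStronglyMeasurable.mul (hφ.comp measurable_snd).aestronglyMeasurable ?_
    rw [Measure.prod_restrict]
    refine ContinuousOn.aestronglyMeasurable ?_ (measurableSet_Ioi.prod measurableSet_Ioi)
    exact hH.comp (by fun_prop) fun p hp => mem_Ioi.2 (mul_pos (mem_Ioi.1 hp.2) (mem_Ioi.1 hp.1))
  rw [integrable_prod_iff' hm]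
  constructor
  · filter_upwards [ae_restrict_mem measurableSet_Ioi] with u hu
    have hu' : 0 < u := hu
    have := (integrableOn_Ioi_comp_mul_left_iff H 0 hu').2 (by simpa using hHi)
    exact Integrable.const_mul this _
  · refine (hφi.norm.mul_const (∫ y in Ioi (0:ℝ), ‖H y‖)).congr ?_
    filter_upwards [ae_restrict_mem measurableSet_Ioi] with u hu
    have hu' : 0 < u := hu
    have := integral_comp_mul_left_Ioi (fun y => ‖H y‖) 0 hu'
    simp only [norm_mul, integral_const_mul]
    rw [this]
    simp [abs_of_pos hu', mul_assoc]

lemma mellin_fubini {v : ℝ → ℂ} {s : ℂ} (hv : ContinuousOn v (Ioi 0))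
    (hvi : MellinConvergent v (s+1)) (h0 : 0 < s.re) (h1 : s.re < 1) {P : ℝ → ℂ}
    (hP : ∀ x : ℝ, 0 < x → P x = ∫ u in Ioi (0:ℝ), ((Int.fract u : ℝ) : ℂ) * (x * v (x * u))) :
    MellinConvergent P s ∧ mellin P s =
      (∫ y in Ioi (0:ℝ), ((Int.fract y : ℝ) : ℂ) * (y:ℂ) ^ (-s-1)) * mellin v (s+1) := by
  let φ : ℝ → ℂ := fun u => ((Int.fract u : ℝ) : ℂ) * (u:ℂ) ^ (-s)
  let H : ℝ → ℂ := fun y => (y:ℂ) ^ s * v y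
  have hφ : Measurable φ := by
    refine Measurable.mul (by fun_prop) ?_
    exact (Complex.measurable_ofReal).pow_const _
  have hφe : ∀ u ∈ Ioi (0:ℝ), φ u * (u:ℂ)⁻¹ = ((Int.fract u : ℝ) : ℂ) * (u:ℂ) ^ (-s-1) := by
    intro u hu
    have hu0 : (u:ℂ) ≠ 0 := by exact_mod_cast (ne_of_gt hu)
    simp only [φ]
    rw [Complex.cpow_sub _ _ hu0, Complex.cpow_one]
    ring
  have hφi : IntegrableOn (fun u : ℝ => φ u * (u:ℂ)⁻¹) (Ioi 0) :=
    (integrableOn_fract_cpow h0 h1).congr_fun (fun u hu => (hφe u hu).symm) measurableSet_Ioi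
  have hH : ContinuousOn H (Ioi 0) := by
    refine ContinuousOn.mul (fun x hx => ?_) hv
    exact (Complex.continuousAt_ofReal_cpow_const _ _ (Or.inr (ne_of_gt hx))).continuousWithinAt
  have hHi : IntegrableOn H (Ioi 0) := by
    simpa [MellinConvergent] using hvi
  have hF := fubini_aux hφ hφi hH hHi
  have hK : ∀ x ∈ Ioi (0:ℝ), (x:ℂ) ^ (s-1) • P x = ∫ u in Ioi (0:ℝ), φ u * H (u * x) := by
    intro x hx
    have hx' : 0 < x := hx
    have hx0 : (x:ℂ) ≠ 0 := by exact_mod_cast hx'.ne'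
    rw [hP x hx, smul_eq_mul, ← integral_const_mul]
    refine setIntegral_congr_fun measurableSet_Ioi fun u hu => ?_
    have hu' : 0 < u := hu
    have hu0 : (u:ℂ) ≠ 0 := by exact_mod_cast hu'.ne'
    have hus : (u:ℂ) ^ s ≠ 0 := by simp [Complex.cpow_eq_zero_iff, hu0]
    simp only [φ, H]
    rw [Complex.ofReal_mul, Complex.mul_cpow_ofReal_nonneg hu'.le hx'.le, Complex.cpow_neg,
      Complex.cpow_sub _ _ hx0, Complex.cpow_one, mul_comm u x]
    field_simp
  constructor
  · have := hF.integral_prod_left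
    exact Integrable.congr this (by
      filter_upwards [ae_restrict_mem measurableSet_Ioi] with x hx using (hK x hx).symm)
  · have e1 : mellin P s = ∫ x in Ioi (0:ℝ), ∫ u in Ioi (0:ℝ), φ u * H (u * x) :=
      setIntegral_congr_fun measurableSet_Ioi hK
    rw [e1, integral_integral_swap hF, ← integral_mul_const]
    refine setIntegral_congr_fun measurableSet_Ioi fun u hu => ?_
    have hu' : 0 < u := hu
    simp only [integral_const_mul]
    rw [← hφe u hu, integral_comp_mul_left_Ioi H 0 hu', mul_zero]
    simp [H, mellin, mul_assoc]

/-- The fractional part representation of the Müntz operator, and its continuity. -/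
lemma class_bound {f : ℝ → ℂ} {α : ℝ} (hα : 0 < α) (hc : ContinuousOn f (Ici 0))
    (ho : f =O[atTop] fun x : ℝ => x ^ (-α)) :
    ∃ C : ℝ, 0 ≤ C ∧ ∀ y : ℝ, 0 < y → ‖f y‖ ≤ C * y ^ (-α) := by
  obtain ⟨A, hA0, hA⟩ := ho.exists_pos
  obtain ⟨X, hX⟩ := eventually_atTop.1 hA.bound
  obtain ⟨B, hB⟩ := (isCompact_Icc (a := (0:ℝ)) (b := max X 1)).exists_bound_of_continuousOn
    (hc.mono Icc_subset_Ici_self)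
  have hB0 : 0 ≤ B := (norm_nonneg _).trans (hB 0 (by simp))
  have hX1 : 0 < max X 1 := by positivity
  refine ⟨A + B * (max X 1) ^ α, by positivity, fun y hy => ?_⟩
  have hyp : 0 < y ^ (-α) := by positivity
  rcases le_total y (max X 1) with h | h
  · have h1 : 1 ≤ (max X 1) ^ α * y ^ (-α) := by
      rw [Real.rpow_neg hy.le, ← div_eq_mul_inv, one_le_div (by positivity)]
      exact Real.rpow_le_rpow hy.le h hα.le
    have h2 := hB y ⟨hy.le, h⟩
    calc ‖f y‖ ≤ B * 1 := by linarith
      _ ≤ B * ((max X 1) ^ α * y ^ (-α)) := by gcongr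
      _ ≤ _ := by nlinarith
  · have h2 := hX y ((le_max_left _ _).trans h)
    rw [Real.norm_eq_abs, abs_of_pos hyp] at h2
    have : 0 ≤ B * (max X 1) ^ α * y ^ (-α) := by positivity
    linarith

lemma summable_shift {α : ℝ} (hα : 1 < α) : Summable fun n : ℕ => ((n:ℝ)+1) ^ (-α) := by
  have := (summable_nat_add_iff 1).2 (Real.summable_nat_rpow.2 (by linarith : -α < -1))
  simpa using this

lemma term_bound {f : ℝ → ℂ} {α C δ : ℝ} (hα : 0 < α) (hC : 0 ≤ C) (hδ : 0 < δ)
    (hb : ∀ y : ℝ, 0 < y → ‖f y‖ ≤ C * y ^ (-α)) (n : ℕ) (x : ℝ) (hx : δ ≤ x) :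
    ‖f ((n + 1 : ℝ) * x)‖ ≤ C * δ ^ (-α) * ((n:ℝ)+1) ^ (-α) := by
  have hn : (0:ℝ) < (n:ℝ)+1 := by positivity
  have hx0 : 0 < x := hδ.trans_le hx
  refine (hb _ (mul_pos hn hx0)).trans ?_
  rw [Real.mul_rpow hn.le hx0.le]
  have : x ^ (-α) ≤ δ ^ (-α) := Real.rpow_le_rpow_of_nonpos hδ hx (by linarith)
  calc C * (((n:ℝ)+1) ^ (-α) * x ^ (-α)) ≤ C * (((n:ℝ)+1) ^ (-α) * δ ^ (-α)) := by gcongr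
    _ = _ := by ring

lemma muntz_continuousAt {f : ℝ → ℂ} {α : ℝ} (hα : 1 < α) (hc : ContinuousOn f (Ici 0))
    (ho : f =O[atTop] fun x : ℝ => x ^ (-α)) {x : ℝ} (hx : 0 < x) :
    ContinuousAt (muntzOp f) x := by
  obtain ⟨C, hC, hb⟩ := class_bound (by linarith) hc ho
  have h1 : ContinuousOn (thetaOp f) (Ici (x/2)) := by
    refine continuousOn_tsum (fun n => ?_) ((summable_shift hα).mul_left (C * (x/2) ^ (-α)))
      (fun n y hy => term_bound (by linarith) hC (by linarith) hb n y hy)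
    refine hc.comp (by fun_prop) fun y hy => ?_
    have : x/2 ≤ y := hy
    exact mem_Ici.2 (mul_nonneg (by positivity) (by linarith))
  have h2 : ContinuousAt (thetaOp f) x := h1.continuousAt (Ici_mem_nhds (by linarith))
  have hx0 : (x:ℂ) ≠ 0 := by exact_mod_cast hx.ne'
  exact h2.sub ((Complex.continuous_ofReal.continuousAt.inv₀ hx0).mul continuousAt_const)

lemma muntz_eq_fract {f v : ℝ → ℂ} {α : ℝ} (hα : 1 < α) (hc : ContinuousOn f (Ici 0))
    (hv : ContinuousOn v (Ici 0)) (huv : ∀ x : ℝ, 0 < x → HasDerivAt f (v x) x)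
    (ho : f =O[atTop] fun x : ℝ => x ^ (-α)) (hov : v =O[atTop] fun x : ℝ => x ^ (-(α+1)))
    {x : ℝ} (hx : 0 < x) :
    muntzOp f x = ∫ u in Ioi (0:ℝ), ((Int.fract u : ℝ) : ℂ) * (x * v (x * u)) := by
  obtain ⟨C, hC, hb⟩ := class_bound (by linarith) hc ho
  have hint : ∀ (g : ℝ → ℂ) (β : ℝ), 1 < β → ContinuousOn g (Ici 0) →
      g =O[atTop] (fun x : ℝ => x ^ (-β)) → IntegrableOn g (Ioi 0) := fun g β hβ hg hgo => by
    have := conv_of_class (s := 1) hg hgo (by simp) (by simpa using hβ)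
    simpa [MellinConvergent] using this
  have hfi := hint f α hα hc ho
  have hvi := hint v (α+1) (by linarith) hv hov
  have hmaps : MapsTo (fun u : ℝ => x * u) (Ici ((0:ℕ):ℝ)) (Ici 0) := fun u hu =>
    mem_Ici.2 (mul_nonneg hx.le (by simpa using hu))
  have h1 := euler_tendsto (fun u => f (x * u)) (fun u => x * v (x * u)) 0
    (hc.comp (by fun_prop) hmaps)
    (continuousOn_const.mul (hv.comp (by fun_prop) hmaps))
    (fun u hu => by
      have := (huv (x * u) (mul_pos hx (by simpa using hu))).scomp u
        ((hasDerivAt_id u).const_mul x)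
      simpa [Function.comp_def] using this)
    (by
      rw [Nat.cast_zero, integrableOn_Ioi_comp_mul_left_iff f 0 hx, mul_zero]; exact hfi)
    (by
      refine Integrable.const_mul (c := (x:ℂ)) (f := fun u => v (x * u)) ?_
      change IntegrableOn (fun u => v (x * u)) (Ioi ((0:ℕ):ℝ))
      rw [Nat.cast_zero, integrableOn_Ioi_comp_mul_left_iff v 0 hx, mul_zero]; exact hvi)
  have hsum : Summable fun n : ℕ => f ((n + 1 : ℝ) * x) :=
    Summable.of_norm_bounded ((summable_shift hα).mul_left (C * x ^ (-α)))
      (fun n => term_bound (by linarith) hC hx hb n x le_rfl)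
  have h2 := hsum.hasSum.tendsto_sum_nat
  have h3 := tendsto_nhds_unique h2 (h1.congr fun k => Finset.sum_congr rfl fun n _ => by
    simp [mul_comm])
  rw [Nat.cast_zero, integral_comp_mul_left_Ioi f 0 hx, mul_zero] at h3
  unfold muntzOp thetaOp
  rw [h3]
  simp

/-- analyticity, `O(|s|⁻²)` decay and integrability of the Mellin transform of a
Müntz-class function, and the line-integral representation of the Müntz operator. -/
theorem muntz_operator_representation (α : ℝ) (hα : 1 < α) (f : ℝ → ℂ)
    (hf : MuntzClass α f) :
    (∀ s : ℂ, 0 < s.re → s.re < α → AnalyticAt ℂ (mellinT f) s) ∧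
    (∀ σ : ℝ, 0 < σ → σ < α →
      ((fun t : ℝ => mellinT f (σ + t * Complex.I)) =O[cocompact ℝ]
        fun t : ℝ => ‖(σ + t * Complex.I : ℂ)‖ ^ (-2 : ℝ)) ∧
      Integrable fun t : ℝ => mellinT f (σ + t * Complex.I)) ∧
    (∀ x : ℝ, 0 < x → ∀ σ : ℝ, 0 < σ → σ < 1 →
      muntzOp f x =
        lineIntegral (fun s => riemannZeta s * mellinT f s * (x : ℂ) ^ (-s)) σ) := by
  obtain ⟨hcd, hO⟩ := hf
  have hun : UniqueDiffOn ℝ (Ici (0:ℝ)) := uniqueDiffOn_Ici 0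
  set g1 : ℝ → ℂ := iteratedDerivWithin 1 f (Ici 0) with hg1
  set g2 : ℝ → ℂ := iteratedDerivWithin 2 f (Ici 0) with hg2
  have c0 : ContinuousOn f (Ici 0) := hcd.continuousOn
  have c1 : ContinuousOn g1 (Ici 0) := hcd.continuousOn_iteratedDerivWithin (by norm_num) hun
  have c2 : ContinuousOn g2 (Ici 0) := hcd.continuousOn_iteratedDerivWithin (by norm_num) hun
  have d0 : ∀ x : ℝ, 0 < x → HasDerivAt f (g1 x) x := fun x hx => by
    have h := (hcd.differentiableOn (by norm_num) x hx.le).hasDerivWithinAt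
    rw [hg1, iteratedDerivWithin_one]
    exact h.hasDerivAt (Ici_mem_nhds hx)
  have d1 : ∀ x : ℝ, 0 < x → HasDerivAt g1 (g2 x) x := fun x hx => by
    have h := (hcd.differentiableOn_iteratedDerivWithin (m := 1) (by norm_num) hun x
      hx.le).hasDerivWithinAt
    rw [hg2, iteratedDerivWithin_succ]
    exact h.hasDerivAt (Ici_mem_nhds hx)
  have o0 : f =O[atTop] fun x : ℝ => x ^ (-α) := by simpa using hO 0 (by norm_num)
  have o1 : g1 =O[atTop] fun x : ℝ => x ^ (-(α+1)) := by
    have h := hO 1 (by norm_num)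
    rwa [Nat.cast_one] at h
  have o2 : g2 =O[atTop] fun x : ℝ => x ^ (-(α+1+1)) := by
    have h := hO 2 le_rfl
    rwa [show α + ((2:ℕ):ℝ) = α+1+1 by push_cast; ring] at h
  have hmel : mellinT f = mellin f := rfl
  rw [hmel]
  have hopen : IsOpen {z : ℂ | 0 < z.re ∧ z.re < α} :=
    (isOpen_lt continuous_const Complex.continuous_re).inter
      (isOpen_lt Complex.continuous_re continuous_const)
  have hline : ∀ σ : ℝ, 0 < σ → σ < α → Continuous fun t : ℝ => mellin f (σ + t * Complex.I) := by
    intro σ h0 h1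
    rw [continuous_iff_continuousAt]
    intro t
    have h : ContinuousAt (mellin f) ((σ:ℂ) + t * Complex.I) :=
      (diff_of_class c0 o0 (by simpa using h0) (by simpa using h1)).continuousAt
    exact ContinuousAt.comp (f := fun t : ℝ => (σ:ℂ) + t * Complex.I) h (by fun_prop)
  have hbound : ∀ σ : ℝ, 0 < σ → σ < α → ∃ C : ℝ, 0 ≤ C ∧ ∀ t : ℝ,
      ‖mellin f (σ + t * Complex.I)‖ ≤ C * ‖(σ + t * Complex.I : ℂ)‖ ^ (-2 : ℝ) := by
    intro σ h0 h1
    refine ⟨∫ x in Ioi (0:ℝ), ‖(x:ℂ) ^ ((σ:ℂ)+1+1-1) • g2 x‖,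
      integral_nonneg fun x => norm_nonneg _, fun t => ?_⟩
    set s : ℂ := σ + t * Complex.I with hs
    have hre : s.re = σ := by simp [hs]
    have e1 := mellin_ibp c0 c1 d0 o0 o1 (s := s) (by rw [hre]; exact h0) (by rw [hre]; exact h1)
    have e2 := mellin_ibp c1 c2 d1 o1 o2 (s := s+1) (by simp [hre]; linarith) (by simp [hre, h1])
    have hle : ‖mellin g2 (s+1+1)‖ ≤ ∫ x in Ioi (0:ℝ), ‖(x:ℂ) ^ ((σ:ℂ)+1+1-1) • g2 x‖ := by
      refine (norm_integral_le_integral_norm _).trans (le_of_eq ?_)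
      refine setIntegral_congr_fun measurableSet_Ioi fun x hx => ?_
      have hx' : 0 < x := hx
      simp only [norm_smul, Complex.norm_cpow_eq_rpow_re_of_pos hx']
      simp [hre]
    have hsp : 0 < ‖s‖ := by
      rw [norm_pos_iff]
      intro h
      rw [h] at hre
      simp at hre
      linarith
    have hs1 : ‖s‖ ≤ ‖s+1‖ := by
      rw [Complex.norm_def, Complex.norm_def]
      refine Real.sqrt_le_sqrt ?_
      simp only [Complex.normSq_apply, add_re, one_re, add_im, one_im, add_zero, hre]
      nlinarith
    have e3 : ‖mellin g2 (s+1+1)‖ = ‖s+1‖ * (‖s‖ * ‖mellin f s‖) := by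
      rw [e2, e1, norm_mul, norm_mul, norm_neg, norm_neg]
    rw [Real.rpow_neg hsp.le, Real.rpow_two, ← div_eq_mul_inv, le_div_iff₀ (by positivity)]
    refine le_trans ?_ hle
    rw [e3]
    have h5 : 0 ≤ ‖s‖ * ‖mellin f s‖ := by positivity
    nlinarith
  refine ⟨fun s h0 h1 => ?_, fun σ h0 h1 => ⟨?_, ?_⟩, fun x hx σ h0 h1 => ?_⟩
  · have hd : DifferentiableOn ℂ (mellin f) {z : ℂ | 0 < z.re ∧ z.re < α} := fun z hz =>
      (diff_of_class c0 o0 hz.1 hz.2).differentiableWithinAt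
    exact hd.analyticAt (hopen.mem_nhds ⟨h0, h1⟩)
  · obtain ⟨C, hC, hb⟩ := hbound σ h0 h1
    refine IsBigO.of_bound C (Eventually.of_forall fun t => ?_)
    refine (hb t).trans ?_
    gcongr
    exact le_abs_self _
  · obtain ⟨C, hC, hb⟩ := hbound σ h0 h1
    refine integrable_of_decay (C := C) (r := 2) (hline σ h0 h1) (by norm_num) fun t ht => ?_
    refine (hb t).trans ?_
    have h2 : |t| ≤ ‖(σ + t * Complex.I : ℂ)‖ := by
      simpa using Complex.abs_im_le_norm (σ + t * Complex.I : ℂ)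
    have h3 := Real.rpow_le_rpow_of_nonpos (z := -2) (by linarith : 0 < |t|) h2 (by norm_num)
    gcongr
  · obtain ⟨C, hC, hb⟩ := hbound σ h0 (h1.trans hα)
    have hF : ∀ s : ℂ, 0 < s.re → s.re < 1 → _ := fun s hs0 hs1 =>
      mellin_fubini (s := s) (c1.mono Ioi_subset_Ici_self)
        (conv_of_class c1 o1 (by simp; linarith) (by simp; linarith)) hs0 hs1
        (P := muntzOp f) (fun x hx => muntz_eq_fract hα c0 c1 d0 o0 o1 hx)
    have hconv : MellinConvergent (muntzOp f) σ := (hF σ (by simpa using h0) (by simpa using h1)).1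
    have hmz : ∀ t : ℝ, t ≠ 0 → mellin (muntzOp f) (σ + t * Complex.I)
        = riemannZeta (σ + t * Complex.I) * mellin f (σ + t * Complex.I) := by
      intro t ht
      set s : ℂ := σ + t * Complex.I with hs
      have hre : s.re = σ := by simp [hs]
      have him : s.im = t := by simp [hs]
      rw [(hF s (by rw [hre]; exact h0) (by rw [hre]; exact h1)).2,
        mellin_ibp c0 c1 d0 o0 o1 (s := s) (by rw [hre]; exact h0) (by rw [hre]; linarith),
        ← integral_fract_cpow (s := s) (by rw [hre]; exact h0) (by rw [hre]; exact h1)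
          (by rw [him]; exact ht)]
      ring
    have hne0 : ∀ᵐ t : ℝ, t ≠ 0 := by
      simp [ae_iff, measure_singleton]
    have hzcont : Continuous fun t : ℝ => riemannZeta (σ + t * Complex.I) := by
      rw [continuous_iff_continuousAt]
      intro t
      have h : ContinuousAt riemannZeta ((σ:ℂ) + t * Complex.I) :=
        (differentiableAt_riemannZeta (fun h => by
          have := congrArg Complex.re h
          simp at this
          linarith)).continuousAt
      exact ContinuousAt.comp (f := fun t : ℝ => (σ:ℂ) + t * Complex.I) h (by fun_prop)
    have hzi : Integrable fun t : ℝ =>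
        riemannZeta (σ + t * Complex.I) * mellin f (σ + t * Complex.I) := by
      refine integrable_of_decay (C := (4 + 2 / σ) * C) (r := 1 + σ/2)
        (hzcont.mul (hline σ h0 (h1.trans hα))) (by linarith) fun t ht => ?_
      have ht0 : 0 < |t| := by linarith
      have h2 : |t| ≤ ‖(σ + t * Complex.I : ℂ)‖ := by
        simpa using Complex.abs_im_le_norm (σ + t * Complex.I : ℂ)
      have h3 := Real.rpow_le_rpow_of_nonpos (z := -2) ht0 h2 (by norm_num)
      rw [norm_mul]
      calc _ ≤ ((4 + 2 / σ) * |t| ^ (1 - σ / 2)) * (C * |t| ^ (-2:ℝ)) := by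
            gcongr
            · exact zeta_bound h0 h1 ht
            · exact (hb t).trans (by gcongr)
        _ = (4 + 2 / σ) * C * |t| ^ (-(1 + σ/2)) := by
            rw [show -(1 + σ/2) = (1 - σ/2) + (-2) by ring, Real.rpow_add ht0]
            ring
    have hvert : VerticalIntegrable (mellin (muntzOp f)) σ := by
      refine hzi.congr ?_
      filter_upwards [hne0] with t ht using (hmz t ht).symm
    rw [← mellinInv_mellin_eq σ (muntzOp f) hx hconv hvert (muntz_continuousAt hα c0 o0 hx)]
    unfold mellinInv lineIntegral
    rw [one_div]
    congr 1
    refine integral_congr_ae ?_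
    filter_upwards [hne0] with t ht
    rw [hmz t ht, smul_eq_mul]
    ring
end
end

section
/- Let α > 1 and let f belong to the Müntz class M_α. Then for all x > 0 the Poisson summation formula holds: √x [ (1/2)(F_c f)(0) + Σ_{n=1}^∞ (F_c f)(nx) ] = √(2π/x) [ (1/2) f(0) + Σ_{n=1}^∞ f(2πn/x) ]. -/
open MeasureTheory Filter Asymptotics Set Complex

noncomputable section

open scoped FourierTransform Topology

lemma muntz_integrable (β : ℝ) (hβ : 1 < β) (g : ℝ → ℂ) (hg : ContinuousOn g (Ici 0))
    (hO : g =O[atTop] fun x : ℝ => x ^ (-β)) : IntegrableOn g (Ioi 0) := by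
  have h : IntegrableOn g (Ici 0) :=
    (hg.locallyIntegrableOn measurableSet_Ici).integrableOn_of_isBigO_atTop hO
      (integrableAtFilter_rpow_atTop_iff.mpr (by linarith))
  exact h.mono_set Ioi_subset_Ici_self

lemma integrableOn_mul_cos (g : ℝ → ℂ) (hg : IntegrableOn g (Ioi 0)) (y : ℝ) :
    IntegrableOn (fun t => g t * (Real.cos (y * t) : ℂ)) (Ioi 0) := by
  refine Integrable.mul_bdd (c := 1) hg ?_ ?_
  · exact (by fun_prop : Continuous fun t : ℝ => (Real.cos (y * t) : ℂ)).aestronglyMeasurable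
  · refine ae_of_all _ fun t => ?_
    rw [Complex.norm_real]
    exact Real.abs_cos_le_one _

lemma cos_decay (α : ℝ) (hα : 1 < α) (f : ℝ → ℂ) (hf : MuntzClass α f) :
    ∃ C : ℝ, ∀ y : ℝ, ‖∫ t in Ioi (0:ℝ), f t * (Real.cos (y * t) : ℂ)‖ * y ^ 2 ≤ C := by
  obtain ⟨hc, hO⟩ := hf
  have hU : UniqueDiffOn ℝ (Ici (0:ℝ)) := uniqueDiffOn_Ici 0
  have hO0 := hO 0 (by norm_num)
  have hO1 := hO 1 (by norm_num)
  have hO2 := hO 2 (by norm_num)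
  have hc1 := hc.continuousOn_iteratedDerivWithin (m := 1) (by norm_num) hU
  have hc2 := hc.continuousOn_iteratedDerivWithin (m := 2) (by norm_num) hU
  have hd0 : ∀ t ∈ Ioi (0:ℝ), HasDerivAt f (iteratedDerivWithin 1 f (Ici 0) t) t := by
    intro t ht
    have h := hc.differentiableOn (by norm_num) t (Ioi_subset_Ici_self ht)
    have h2 := h.hasDerivWithinAt.hasDerivAt (Ici_mem_nhds ht)
    rwa [iteratedDerivWithin_one]
  have hd1 : ∀ t ∈ Ioi (0:ℝ), HasDerivAt (iteratedDerivWithin 1 f (Ici 0))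
      (iteratedDerivWithin 2 f (Ici 0) t) t := by
    intro t ht
    have h := hc.differentiableOn_iteratedDerivWithin (m := 1) (by norm_num) hU t (Ioi_subset_Ici_self ht)
    have h2 := h.hasDerivWithinAt.hasDerivAt (Ici_mem_nhds ht)
    rwa [← iteratedDerivWithin_succ] at h2
  set f1 := iteratedDerivWithin 1 f (Ici 0)
  set f2 := iteratedDerivWithin 2 f (Ici 0)
  rw [iteratedDerivWithin_zero] at hO0
  have hi0 := muntz_integrable _ (by norm_num; linarith) f hc.continuousOn hO0
  have hi2 := muntz_integrable _ (by norm_num; linarith) f2 hc2 hO2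
  have ht0 : Tendsto f atTop (𝓝 0) :=
    hO0.trans_tendsto (tendsto_rpow_neg_atTop (by norm_num; linarith))
  have ht1 : Tendsto f1 atTop (𝓝 0) :=
    hO1.trans_tendsto (tendsto_rpow_neg_atTop (by norm_num; linarith))
  refine ⟨‖f1 0‖ + ∫ t in Ioi (0:ℝ), ‖f2 t‖, fun y => ?_⟩
  have j0 := integrableOn_mul_cos f hi0 y
  have j2 := integrableOn_mul_cos f2 hi2 y
  have key : ∫ t in Ioi (0:ℝ), ((y:ℂ) ^ 2 * (f t * (Real.cos (y * t) : ℂ))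
      + f2 t * (Real.cos (y * t) : ℂ)) = 0 - f1 0 := by
    have := integral_Ioi_of_hasDerivAt_of_tendsto (a := (0:ℝ)) (m := (0:ℂ))
      (f := fun t => (y:ℂ) * (f t * (Real.sin (y * t) : ℂ)) + f1 t * (Real.cos (y * t) : ℂ))
      (f' := fun t => (y:ℂ) ^ 2 * (f t * (Real.cos (y * t) : ℂ))
        + f2 t * (Real.cos (y * t) : ℂ)) ?_ ?_ ?_ ?_
    · simpa using this
    · have h0 : ContinuousWithinAt f (Ici 0) 0 := hc.continuousOn 0 self_mem_Ici
      have h1 : ContinuousWithinAt f1 (Ici 0) 0 := hc1 0 self_mem_Ici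
      have hs : Continuous fun t : ℝ => (Real.sin (y * t) : ℂ) := by fun_prop
      have hcs : Continuous fun t : ℝ => (Real.cos (y * t) : ℂ) := by fun_prop
      exact (continuousWithinAt_const.mul (h0.mul hs.continuousWithinAt)).add
        (h1.mul hcs.continuousWithinAt)
    · intro t ht
      have hm : HasDerivAt (fun t : ℝ => y * t) y t := by
        simpa using (hasDerivAt_id t).const_mul y
      have hs := (hm.sin).ofReal_comp
      have hcs := (hm.cos).ofReal_comp
      refine (((((hd0 t ht).mul hs).const_mul (y:ℂ)).add ((hd1 t ht).mul hcs))).congr_deriv ?_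
      push_cast
      ring
    · exact (j0.const_mul _).add j2
    · have b : ∀ (g : ℝ → ℂ) (c : ℝ → ℝ), Tendsto g atTop (𝓝 0) → (∀ t, |c t| ≤ 1) →
          Tendsto (fun t => g t * (c t : ℂ)) atTop (𝓝 0) := by
        intro g c hg hc
        refine squeeze_zero_norm (a := fun t => ‖g t‖) (fun t => ?_) (by simpa using hg.norm)
        rw [norm_mul, Complex.norm_real]
        exact mul_le_of_le_one_right (norm_nonneg _) (hc t)
      simpa using ((b f _ ht0 (fun t => Real.abs_sin_le_one (y * t))).const_mul (y:ℂ)).add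
        (b f1 _ ht1 (fun t => Real.abs_cos_le_one (y * t)))
  rw [integral_add (j0.const_mul _) j2, integral_const_mul] at key
  have e : (y:ℂ) ^ 2 * (∫ t in Ioi (0:ℝ), f t * (Real.cos (y * t) : ℂ))
      = -f1 0 - ∫ t in Ioi (0:ℝ), f2 t * (Real.cos (y * t) : ℂ) := by
    linear_combination key
  have e2 : ‖∫ t in Ioi (0:ℝ), f t * (Real.cos (y * t) : ℂ)‖ * y ^ 2
      = ‖-f1 0 - ∫ t in Ioi (0:ℝ), f2 t * (Real.cos (y * t) : ℂ)‖ := by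
    rw [← e, norm_mul, norm_pow, Complex.norm_real, Real.norm_eq_abs, sq_abs, mul_comm]
  rw [e2]
  refine (norm_sub_le _ _).trans ?_
  rw [norm_neg]
  gcongr
  refine (norm_integral_le_integral_norm _).trans ?_
  refine integral_mono j2.norm hi2.norm fun t => ?_
  simp only [norm_mul, Complex.norm_real]
  exact mul_le_of_le_one_right (norm_nonneg _) (Real.abs_cos_le_one _)

lemma fourier_even (g : ℝ → ℂ) (hg : Integrable fun t => g |t|) (ξ : ℝ) :
    𝓕 (fun t => g |t|) ξ
      = 2 * ∫ t in Ioi (0:ℝ), g t * (Real.cos (2 * Real.pi * ξ * t) : ℂ) := by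
  rw [Real.fourier_real_eq_integral_exp_smul]
  set h : ℝ → ℂ := fun v => Complex.exp (↑(-2 * Real.pi * v * ξ) * Complex.I) • g |v| with hh
  have hi : Integrable h := by
    refine Integrable.bdd_mul (c := 1) hg ?_ ?_
    · exact (by fun_prop : Continuous fun v : ℝ =>
        Complex.exp (↑(-2 * Real.pi * v * ξ) * Complex.I)).aestronglyMeasurable
    · exact ae_of_all _ fun t => (Complex.norm_exp_ofReal_mul_I _).le
  rw [← intervalIntegral.integral_Iic_add_Ioi (b := 0) hi.integrableOn hi.integrableOn]
  have e1 : ∫ v in Iic (0:ℝ), h v = ∫ v in Ioi (0:ℝ), h (-v) := by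
    have := integral_comp_neg_Ioi (0:ℝ) h
    rw [this, neg_zero]
  rw [e1, ← integral_add hi.comp_neg.integrableOn hi.integrableOn, ← integral_const_mul]
  refine setIntegral_congr_fun measurableSet_Ioi fun t ht => ?_
  have ht' : |t| = t := abs_of_pos ht
  simp only [hh, abs_neg, ht', smul_eq_mul]
  have e2 : Complex.exp (↑(-2 * Real.pi * -t * ξ) * Complex.I)
      + Complex.exp (↑(-2 * Real.pi * t * ξ) * Complex.I)
      = 2 * Complex.cos (↑(2 * Real.pi * ξ * t)) := by
    rw [Complex.two_cos]
    congr 2 <;> · push_cast; ring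
  rw [Complex.ofReal_cos]
  linear_combination (g t) * e2

/-- the Poisson summation formula for functions of the Müntz class. -/
theorem poisson_summation (α : ℝ) (hα : 1 < α) (f : ℝ → ℂ) (hf : MuntzClass α f) :
    ∀ x : ℝ, 0 < x →
      (Real.sqrt x : ℂ) *
          ((1 / 2) * fourierCos f 0 + ∑' n : ℕ, fourierCos f ((n + 1 : ℝ) * x)) =
        (Real.sqrt (2 * Real.pi / x) : ℂ) *
          ((1 / 2) * f 0 + ∑' n : ℕ, f (2 * Real.pi * (n + 1 : ℝ) / x)) := by
  intro x hx
  obtain ⟨C, hC⟩ := cos_decay α hα f hf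
  obtain ⟨hc, hO⟩ := hf
  have hO0 := hO 0 (by norm_num)
  rw [iteratedDerivWithin_zero] at hO0
  simp only [Nat.cast_zero, add_zero] at hO0
  have hpi := Real.pi_pos
  set c : ℝ := 2 * Real.pi / x with hcdef
  have hcpos : 0 < c := by positivity
  set I : ℝ → ℂ := fun y => ∫ t in Ioi (0:ℝ), f t * (Real.cos (y * t) : ℂ) with hI
  set g : ℝ → ℂ := fun t => f (c * |t|) with hg
  have gcont : Continuous g := by
    refine hc.continuousOn.comp_continuous (by fun_prop) fun t => ?_
    exact mul_nonneg hcpos.le (abs_nonneg t)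
  have gtop : (fun t => f (c * t)) =O[atTop] fun x : ℝ => x ^ (-α) := by
    have h1 := hO0.comp_tendsto (tendsto_id.const_mul_atTop hcpos)
    refine h1.trans (IsBigO.of_bound (c ^ (-α)) ?_)
    filter_upwards [eventually_ge_atTop 0] with t ht
    simp only [Function.comp, id]
    rw [Real.mul_rpow hcpos.le ht, norm_mul, Real.norm_of_nonneg (by positivity)]
  have gO : g =O[cocompact ℝ] fun x : ℝ => |x| ^ (-α) :=
    gtop.comp_tendsto (tendsto_norm_cocompact_atTop (E := ℝ))
  have gint : Integrable g := by
    refine gcont.locallyIntegrable.integrable_of_isBigO_atTop_of_norm_isNegInvariant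
      (g := fun x => x ^ (-α)) ?_ ?_ (integrableAtFilter_rpow_atTop_iff.mpr (by linarith))
    · exact ae_of_all _ fun t => by simp [hg]
    · refine gtop.congr' ?_ EventuallyEq.rfl
      filter_upwards [eventually_ge_atTop 0] with t ht
      simp [hg, abs_of_nonneg ht]
  have gF : ∀ ξ : ℝ, 𝓕 g ξ = 2 / (c:ℂ) * I (ξ * x) := by
    intro ξ
    have h1 := fourier_even (fun t => f (c * t)) gint ξ
    refine h1.trans ?_
    have h2 := integral_comp_mul_left_Ioi
      (fun u => f u * (Real.cos (ξ * x * u) : ℂ)) 0 hcpos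
    have h3 : ∀ t : ℝ, ξ * x * (c * t) = 2 * Real.pi * ξ * t := by
      intro t; rw [hcdef]; field_simp
    simp only [h3, mul_zero] at h2
    rw [h2, Complex.real_smul, Complex.ofReal_inv]
    simp only [hI]
    ring
  have Ieven : ∀ y, I (-y) = I y := by intro y; simp [hI]
  have Isum : Summable fun n : ℤ => I (n * x) := by
    refine Summable.of_norm_bounded_eventually (g := fun n : ℤ => C / x ^ 2 * |(n:ℝ)| ^ (-2:ℝ)) 
      ((Real.summable_abs_int_rpow (by norm_num)).mul_left _) ?_
    have : ∀ᶠ n : ℤ in cofinite, n ≠ 0 := (finite_singleton (0:ℤ)).compl_mem_cofinite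
    filter_upwards [this] with n hn
    have hn' : (n:ℝ) ≠ 0 := by exact_mod_cast hn
    rw [Real.rpow_neg (abs_nonneg _), Real.rpow_two, sq_abs, ← div_eq_mul_inv, div_div,
      le_div_iff₀ (by positivity)]
    have := hC (n * x)
    rwa [mul_pow, mul_comm ((n:ℝ)^2)] at this
  have gFsum : Summable fun n : ℤ => 𝓕 g n := by
    simp only [gF]
    exact Isum.mul_left _
  have gsum : Summable fun n : ℤ => g n :=
    summable_of_isBigO (Real.summable_abs_int_rpow hα) (gO.comp_tendsto Int.tendsto_coe_cofinite)
  have P := Real.tsum_eq_tsum_fourier_of_rpow_decay_of_summable gcont hα gO gFsum 0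
  have P1 : ∑' n : ℤ, g n = 2 / (c:ℂ) * ∑' n : ℤ, I (n * x) := by
    rw [← tsum_mul_left]
    simpa [gF] using P
  have T1 := tsum_int_eq_zero_add_two_mul_tsum_pnat (f := fun n : ℤ => g n)
    (fun n => by simp [hg]) gsum
  have T2 := tsum_int_eq_zero_add_two_mul_tsum_pnat (f := fun n : ℤ => I (n * x))
    (fun n => by simp [Ieven]) Isum
  have S1 : ∑' n : ℕ+, g ((n:ℤ):ℝ) = ∑' n : ℕ, f (2 * Real.pi * (n + 1 : ℝ) / x) := by
    have := tsum_pnat_eq_tsum_succ (f := fun n : ℕ => g (n:ℝ))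
    simp only [Int.cast_natCast]
    rw [this]
    refine tsum_congr fun n => ?_
    simp only [hg, hcdef]
    rw [abs_of_nonneg (by positivity)]
    congr 1
    push_cast
    ring
  have S2 : ∑' n : ℕ+, I (((n:ℤ):ℝ) * x) = ∑' n : ℕ, I ((n + 1 : ℝ) * x) := by
    have := tsum_pnat_eq_tsum_succ (f := fun n : ℕ => I (n * x))
    simp only [Int.cast_natCast]
    rw [this]
    simp
  rw [T1, T2, S1, S2] at P1
  have hfc : ∀ y, fourierCos f y = (Real.sqrt (2 / Real.pi) : ℂ) * I y := fun y => rfl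
  simp only [hfc, tsum_mul_left]
  simp only [hg, Int.cast_zero, abs_zero, mul_zero, zero_mul, nsmul_eq_mul] at P1
  set A := ∑' n : ℕ, I ((n + 1 : ℝ) * x)
  set B := ∑' n : ℕ, f (2 * Real.pi * (n + 1 : ℝ) / x)
  have hs : Real.sqrt x * Real.sqrt (2 / Real.pi) = Real.sqrt c * (2 / c) := by
    have h1 : x = 2 * Real.pi / c := by rw [hcdef]; field_simp
    have h2 : Real.sqrt c * (2 / c) = 2 / Real.sqrt c := by
      have := Real.mul_self_sqrt hcpos.le
      have h3 : Real.sqrt c ≠ 0 := by positivity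
      field_simp
      nlinarith
    rw [← Real.sqrt_mul hx.le, h2]
    have h4 : x * (2 / Real.pi) = 2 ^ 2 / c := by rw [h1]; field_simp
    rw [h4, Real.sqrt_div (by norm_num), Real.sqrt_sq (by norm_num)]
  have hs' : (Real.sqrt x : ℂ) * (Real.sqrt (2 / Real.pi) : ℂ) = (Real.sqrt c : ℂ) * (2 / (c:ℂ)) := by
    exact_mod_cast hs
  push_cast at P1
  linear_combination (1 / 2 * I 0 + A) * hs' - (Real.sqrt c : ℂ) / 2 * P1
end
end
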